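/- Let S be a nonempty finite set, let A be a symmetric real S×S sub-generator (A_{x,y} ≥ 0 for x ≠ y and Σ_{y∈S} A_{x,y} ≤ 0 for all x), let B be its off-diagonal part, and set η_S = max{ max_{x∈S} Σ_{y∈S∖{x}} |B_{x,y}|, 1 }. Fix a ∈ S, T ≥ 1, and a Borel measurable set Γ ⊆ M_1(S), where M_1(S) = { μ ∈ [0,1]^S : Σ_{x∈S} μ_x = 1 }. For R ⊆ S and l ∈ M_T^+(R), let ext_S(l/T) ∈ M_1(S) be l/T on R and 0 on S∖R, and let ρ_{ab}^{(R)} denote the local-time density built from the submatrix A_{R×R}. Then Σ_{b∈S} Σ_{R : {a,b} ⊆ R ⊆ S} ∫_{M_T^+(R)} 1_Γ(ext_S(l/T)) ρ_{ab}^{(R)}(l) σ_T(dl) ≤ |S| · (η_S √(8e) T)^{|S|} · e^{|S|/(4T)} · exp(−T · inf_{μ∈Γ} Σ_{x,y∈S} √(μ_x)(−A_{x,y})√(μ_y)), with the convention inf over the empty set = +∞. -/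

import Mathlib

open MeasureTheory Finset

noncomputable section

/-- The `(b,a)` cofactor of the `S × S` submatrix of `M`. -/
def cofDet {α : Type*} [Fintype α] [DecidableEq α]
    (S : Finset α) (M : Matrix α α ℂ) (a b : α) : ℂ :=
  (Matrix.of fun x y : S => if (x : α) = b then (if (y : α) = a then (1:ℂ) else 0)
    else (if (y : α) = a then 0 else M x y)).det

/-- Partial derivative in direction `x`. -/
def pd {α : Type*} [Fintype α] [DecidableEq α] (x : α) (f : (α → ℝ) → ℂ) :
    (α → ℝ) → ℂ :=
  fun l => fderiv ℝ f l (Pi.single x 1)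

/-- Mixed partial derivative `∂^Q f`. -/
def mpart {α : Type*} [Fintype α] [DecidableEq α] (Q : Finset α) (f : (α → ℝ) → ℂ) :
    (α → ℝ) → ℂ :=
  Q.toList.foldr pd f

/-- The differential operator `det_{ab}^{(α)}(M + ∂_l)` applied to `f` at `l`. -/
def ddet {α : Type*} [Fintype α] [DecidableEq α]
    (M : Matrix α α ℂ) (a b : α) (f : (α → ℝ) → ℂ) (l : α → ℝ) : ℂ :=
  ∑ Q ∈ ((Finset.univ : Finset α) \ {a, b}).powerset,
    cofDet ((Finset.univ : Finset α) \ Q) M a b * mpart Q f l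

/-- `G_M(l) = ∫_{[0,2π]^α} exp(Σ_{x,y} M_{x,y} √(l_x l_y) e^{i(θ_x−θ_y)}) ∏ dθ_x/(2π)`. -/
def GM {α : Type*} [Fintype α] [DecidableEq α] (M : Matrix α α ℝ) (l : α → ℝ) : ℂ :=
  ((2 * Real.pi : ℂ) ^ (Fintype.card α))⁻¹ *
    ∫ θ in Set.univ.pi (fun _ : α => Set.Icc (0:ℝ) (2 * Real.pi)),
      Complex.exp (∑ x, ∑ y, (M x y : ℂ) * (Real.sqrt (l x * l y) : ℂ) *
        Complex.exp (Complex.I * ((θ x : ℂ) - (θ y : ℂ))))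

/-- The local-time density `ρ_{ab}(l) = (det_{ab}(−A + ∂_l) G_A)(l)`. -/
def rho {α : Type*} [Fintype α] [DecidableEq α]
    (A : Matrix α α ℝ) (a b : α) (l : α → ℝ) : ℂ :=
  ddet ((-A).map (fun r => (r : ℂ))) a b (GM A) l

/-- The `σ_T` integral over the open simplex `M_T^+(α) = {l ∈ (0,∞)^α : Σ l_x = T}`,
parametrized by dropping the coordinate `a` (`ℝ≥0∞`-valued version). -/
def sigmaLInt {α : Type*} [Fintype α] [DecidableEq α] (a : α) (T : ℝ)
    (h : (α → ℝ) → ENNReal) : ENNReal :=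
  ∫⁻ t in {t : {x : α // x ≠ a} → ℝ | (∀ x, 0 < t x) ∧ ∑ x, t x < T},
    h (fun x => if hx : x = a then T - ∑ y, t y else t ⟨x, hx⟩)


section helpers

/-- Expansion of the determinant of a diagonal perturbation. -/
lemma det_add_diag_expand {α : Type*} [Fintype α] [DecidableEq α]
    (N : Matrix α α ℂ) (W : α → ℂ) :
    (N + Matrix.diagonal W).det = ∑ s : Finset α,
      (Matrix.of fun x y : s => N x y).det * ∏ x ∈ sᶜ, W x := by
  have h := (Matrix.detRowAlternating (n := α) (R := ℂ)).map_add_univ N (Matrix.diagonal W)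
  change (N + Matrix.diagonal W).det = _ at h
  rw [h]
  refine Finset.sum_congr rfl fun s _ => ?_
  have hP : Matrix.detRowAlternating (s.piecewise N (Matrix.diagonal W)) =
      (Matrix.of fun x y => if x ∈ s then N x y else Matrix.diagonal W x y).det := by
    change Matrix.det _ = _
    congr 1
    ext x y
    by_cases hx : x ∈ s <;> simp [Finset.piecewise, hx]
  rw [hP]
  rw [Matrix.twoBlockTriangular_det _ (fun x => x ∈ s)]
  · have h1 : (Matrix.toSquareBlockProp
        (Matrix.of fun x y => if x ∈ s then N x y else Matrix.diagonal W x y) fun i => i ∈ s)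
          = (Matrix.of fun x y : s => N x y) := by
      ext x y
      have hx : (x : α) ∈ s := x.2
      simp only [Matrix.toSquareBlockProp_def, Matrix.of_apply, if_pos hx]
    have h2 : (Matrix.toSquareBlockProp
        (Matrix.of fun x y => if x ∈ s then N x y else Matrix.diagonal W x y) fun i => ¬ i ∈ s)
          = Matrix.diagonal (fun x : {i // ¬ i ∈ s} => W x) := by
      ext x y
      have hx : (x : α) ∉ s := x.2
      simp only [Matrix.toSquareBlockProp_def, Matrix.of_apply, if_neg hx,
        Matrix.diagonal_apply, Subtype.ext_iff]
    rw [h1, h2, Matrix.det_diagonal]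
    have h3 : ∏ x ∈ sᶜ, W x = ∏ x : {i // ¬ i ∈ s}, W x := 
      Finset.prod_subtype _ (by simp) _
    rw [h3]
    congr!
  · intro i hi j hj
    have : i ≠ j := fun h => hi (h ▸ hj)
    simp [hi, Matrix.diagonal_apply, this]

/-- The symbol of the differential operator. -/
lemma sum_cofDet {α : Type*} [Fintype α] [DecidableEq α]
    (M : Matrix α α ℂ) (a b : α) (V : α → ℂ) :
    ∑ Q ∈ ((Finset.univ : Finset α) \ {a, b}).powerset,
      cofDet ((Finset.univ : Finset α) \ Q) M a b * ∏ x ∈ Q, V x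
    = (Matrix.of fun x y : α => if x = b then (if y = a then (1:ℂ) else 0)
    else (if y = a then 0 else (M + Matrix.diagonal V) x y)).det := by
  set N : Matrix α α ℂ := Matrix.of fun x y : α => if x = b then (if y = a then (1:ℂ) else 0)
    else (if y = a then 0 else M x y) with hN
  set W : α → ℂ := fun x => if x = a ∨ x = b then 0 else V x with hW
  have h1 : (Matrix.of fun x y : α => if x = b then (if y = a then (1:ℂ) else 0)
    else (if y = a then 0 else (M + Matrix.diagonal V) x y)) = N + Matrix.diagonal W := by
    ext x y
    simp only [hN, hW, Matrix.of_apply, Matrix.add_apply, Matrix.diagonal_apply]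
    by_cases h1 : x = b <;> by_cases h2 : y = a <;> by_cases h3 : x = y <;> simp_all
  rw [h1, det_add_diag_expand]
  rw [← (Equiv.sum_comp (Function.Involutive.toPerm (compl : Finset α → Finset α) compl_involutive)
    (fun s : Finset α => (Matrix.of fun x y : s => N x y).det * ∏ x ∈ sᶜ, W x))] 
  rw [← Finset.sum_subset (Finset.subset_univ (((Finset.univ : Finset α) \ {a, b}).powerset))]
  · refine Finset.sum_congr rfl fun Q hQ => ?_
    rw [Finset.mem_powerset] at hQ
    rw [← Finset.compl_eq_univ_sdiff Q]
    simp only [Function.Involutive.coe_toPerm, compl_compl]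
    congr 1
    refine Finset.prod_congr rfl fun x hx => ?_
    have := hQ hx
    simp at this
    simp [hW, this]
  · intro Q _ hQ
    simp only [Function.Involutive.coe_toPerm, compl_compl]
    rw [Finset.mem_powerset, Finset.not_subset] at hQ
    obtain ⟨x, hx, hx'⟩ := hQ
    have : W x = 0 := by
      simp at hx'
      simp only [hW]
      rw [if_pos]
      tauto
    rw [Finset.prod_eq_zero hx this, mul_zero]

lemma norm_det_le_cols {α : Type*} [Fintype α] [DecidableEq α] (M : Matrix α α ℂ) :
    ‖M.det‖ ≤ ∏ y, ∑ x, ‖M x y‖ := by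
  rw [Matrix.det_apply, Finset.prod_univ_sum]
  refine (norm_sum_le _ _).trans ?_
  have : ∀ σ : Equiv.Perm α, ‖Equiv.Perm.sign σ • ∏ i, M (σ i) i‖ = ∏ i, ‖M (σ i) i‖ := by
    intro σ
    rw [Units.smul_def, zsmul_eq_mul, norm_mul, norm_prod]
    rcases Int.units_eq_one_or (Equiv.Perm.sign σ) with h | h <;> simp [h]
  simp_rw [this]
  rw [← Finset.sum_image (s := Finset.univ) (g := fun σ : Equiv.Perm α => (σ : α → α))
    (f := fun p : α → α => ∏ i, ‖M (p i) i‖)]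
  · refine Finset.sum_le_sum_of_subset_of_nonneg ?_ ?_
    · intro p _; simp
    · intro p _ _; positivity
  · intro σ _ τ _ h
    exact DFunLike.coe_injective h

lemma hasFDerivAt_int {𝕜 E X : Type*} [RCLike 𝕜] [NormedAddCommGroup E] [NormedSpace 𝕜 E]
    [ProperSpace E] [TopologicalSpace X] [CompactSpace X] [MeasurableSpace X]
    [OpensMeasurableSpace X] [SecondCountableTopology X] [NormedSpace 𝕜 ℂ]
    (μ : Measure X) [IsFiniteMeasure μ] [NormedSpace ℝ ℂ] [SMulCommClass ℝ 𝕜 ℂ]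
    (F : E → X → ℂ) (F' : E → X → E →L[𝕜] ℂ)
    (hF : ∀ e, Continuous (F e)) (hF' : Continuous (Function.uncurry F'))
    (hd : ∀ e x, HasFDerivAt (fun e => F e x) (F' e x) e) (e₀ : E) :
    HasFDerivAt (fun e => ∫ x, F e x ∂μ) (∫ x, F' e₀ x ∂μ) e₀ := by
  obtain ⟨C, hC⟩ := (((isCompact_closedBall e₀ 1).prod isCompact_univ).exists_bound_of_continuousOn
    (hF'.continuousOn (s := Metric.closedBall e₀ 1 ×ˢ (Set.univ : Set X))))
  refine hasFDerivAt_integral_of_dominated_of_fderiv_le (s := Metric.closedBall e₀ 1)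
    (bound := fun _ => C) (Metric.closedBall_mem_nhds _ one_pos) ?_ ?_ ?_ ?_ ?_ ?_
  · exact Filter.Eventually.of_forall fun e => (hF e).aestronglyMeasurable
  · exact (hF e₀).integrable_of_hasCompactSupport (HasCompactSupport.of_compactSpace _)
  · have : Continuous (F' e₀) := by fun_prop
    exact this.aestronglyMeasurable
  · exact Filter.Eventually.of_forall fun x e he => hC (e, x) ⟨he, trivial⟩
  · exact integrable_const _
  · exact Filter.Eventually.of_forall fun x e he => hd e x

end helpers

section torus

set_option linter.unusedSectionVars false

open Real in
instance factTwoPi : Fact (0 < 2 * π) := ⟨Real.two_pi_pos⟩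

/-- The torus. -/
abbrev Tor (α : Type*) := α → AddCircle (2 * Real.pi)

/-- The phase `e^{i(θ_x−θ_y)}`. -/
def ph {α : Type*} (t : Tor α) (x y : α) : ℂ := (AddCircle.toCircle (t x - t y) : ℂ)

lemma continuous_ph {α : Type*} (x y : α) : Continuous (fun t : Tor α => ph t x y) := by
  unfold ph
  have := @AddCircle.continuous_toCircle (2 * Real.pi)
  fun_prop

lemma norm_ph {α : Type*} (t : Tor α) (x y : α) : ‖ph t x y‖ = 1 := Circle.norm_coe _

lemma ph_self {α : Type*} (t : Tor α) (x : α) : ph t x x = 1 := by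
  simp [ph]

lemma ph_coe {α : Type*} (θ : α → ℝ) (x y : α) :
    ph (fun x => ((θ x : ℝ) : AddCircle (2 * Real.pi))) x y
      = Complex.exp (Complex.I * ((θ x : ℂ) - (θ y : ℂ))) := by
  unfold ph
  rw [← AddCircle.coe_sub, AddCircle.toCircle_apply_mk, Circle.coe_exp]
  congr 1
  have : (Real.pi : ℂ) ≠ 0 := by exact_mod_cast Real.pi_ne_zero
  push_cast
  field_simp

lemma ph_shift {α : Type*} (t : Tor α) (s : α → ℝ) (x y : α) :
    ph (t + fun x => ((s x : ℝ) : AddCircle (2 * Real.pi))) x y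
      = ph t x y * Complex.exp (Complex.I * ((s x : ℂ) - (s y : ℂ))) := by
  rw [← ph_coe]
  unfold ph
  rw [← Circle.coe_mul, ← AddCircle.toCircle_add]
  congr 2
  simp only [Pi.add_apply]
  abel

variable {α : Type*} [Fintype α] [DecidableEq α]

lemma int_cube_eq_torus (f : Tor α → ℂ) (hf : Continuous f) :
    ∫ θ in Set.univ.pi (fun _ : α => Set.Icc (0:ℝ) (2 * Real.pi)),
      f (fun x => ((θ x : ℝ) : AddCircle (2 * Real.pi))) = ∫ t, f t := by
  have h := measurePreserving_pi (fun _ : α => (volume : Measure ℝ).restrict (Set.Ioc 0 (0 + 2 * Real.pi)))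
    (fun _ : α => (volume : Measure (AddCircle (2 * Real.pi))))
    (f := fun _ => ((↑) : ℝ → AddCircle (2 * Real.pi)))
    (fun _ => AddCircle.measurePreserving_mk (2 * Real.pi) 0)
  have h2 : (volume : Measure (Tor α)) = Measure.pi (fun _ => volume) := rfl
  rw [h2, ← h.map_eq, integral_map h.measurable.aemeasurable hf.aestronglyMeasurable]
  have h3 : (volume : Measure (α → ℝ)) = Measure.pi (fun _ => volume) := rfl
  rw [h3, Measure.restrict_pi_pi]
  have : (fun _ : α => (volume : Measure ℝ).restrict (Set.Icc 0 (2 * Real.pi)))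
    = (fun _ : α => (volume : Measure ℝ).restrict (Set.Ioc 0 (0 + 2 * Real.pi))) := by
    ext1 _
    rw [zero_add]
    exact (Measure.restrict_congr_set Ioc_ae_eq_Icc).symm
  rw [this]

lemma vol_torus : (volume : Measure (Tor α)).real Set.univ = (2 * Real.pi) ^ Fintype.card α := by
  rw [measureReal_def, ← Set.pi_univ Set.univ]
  rw [volume_pi_pi]
  simp [AddCircle.measure_univ, Real.pi_pos.le]

lemma GM_torus (M : Matrix α α ℝ) (l : α → ℝ) :
    GM M l = ((2 * Real.pi : ℂ) ^ (Fintype.card α))⁻¹ *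
      ∫ t : Tor α, Complex.exp (∑ x, ∑ y, ((M x y : ℂ) * (Real.sqrt (l x * l y) : ℂ)) * ph t x y) := by
  rw [← int_cube_eq_torus]
  · simp only [GM, ph_coe]
  · have := fun x y => continuous_ph (α := α) x y
    fun_prop

/-- The contour-shifted integral. -/
def KK (N : α → α → ℂ) (v : α → ℝ) (z : ℂ) : ℂ :=
  ∫ t : Tor α, Complex.exp (∑ x, ∑ y, N x y * ph t x y * Complex.exp (z * ((v x - v y : ℝ) : ℂ)))

lemma KK_diff (N : α → α → ℂ) (v : α → ℝ) : Differentiable ℂ (KK N v) := by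
  intro z
  have hc := fun x y => continuous_ph (α := α) x y
  refine (hasFDerivAt_int (𝕜 := ℂ) (E := ℂ) (X := Tor α) volume
    (fun z t => Complex.exp (∑ x, ∑ y, N x y * ph t x y * Complex.exp (z * ((v x - v y : ℝ) : ℂ))))
    (fun z t => (ContinuousLinearMap.toSpanSingleton ℂ
      (Complex.exp (∑ x, ∑ y, N x y * ph t x y * Complex.exp (z * ((v x - v y : ℝ) : ℂ))) *
      ∑ x, ∑ y, N x y * ph t x y * (Complex.exp (z * ((v x - v y : ℝ) : ℂ)) * ((v x - v y : ℝ) : ℂ)))))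
    ?_ ?_ ?_ z).differentiableAt
  · intro e; fun_prop
  · have : Continuous (ContinuousLinearMap.toSpanSingletonCLE (𝕜 := ℂ) (E := ℂ)) :=
      (ContinuousLinearMap.toSpanSingletonCLE (𝕜 := ℂ) (E := ℂ)).continuous
    refine this.comp (f := fun p : ℂ × Tor α => (Complex.exp (∑ x, ∑ y, N x y * ph p.2 x y * Complex.exp (p.1 * ((v x - v y : ℝ) : ℂ))) *
      ∑ x, ∑ y, N x y * ph p.2 x y * (Complex.exp (p.1 * ((v x - v y : ℝ) : ℂ)) * ((v x - v y : ℝ) : ℂ)))) ?_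
    have hc' : ∀ x y, Continuous (fun p : ℂ × Tor α => ph p.2 x y) :=
      fun x y => (hc x y).comp continuous_snd
    fun_prop
  · intro e t
    rw [← hasDerivAt_iff_hasFDerivAt]
    refine HasDerivAt.cexp ?_
    refine HasDerivAt.fun_sum fun x _ => HasDerivAt.fun_sum fun y _ => ?_
    refine HasDerivAt.const_mul _ ?_
    refine HasDerivAt.cexp ?_
    simpa using (hasDerivAt_id e).mul_const ((v x - v y : ℝ) : ℂ)

lemma KK_const (N : α → α → ℂ) (v : α → ℝ) (z : ℂ) : KK N v z = KK N v 0 := by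
  have h1 : AnalyticOnNhd ℂ (KK N v) Set.univ :=
    (KK_diff N v).differentiableOn.analyticOnNhd isOpen_univ
  have h2 : AnalyticOnNhd ℂ (fun _ : ℂ => KK N v 0) Set.univ := analyticOnNhd_const
  have key : ∀ s : ℝ, KK N v (Complex.I * s) = KK N v 0 := by
    intro s
    unfold KK
    rw [← integral_add_right_eq_self (μ := (volume : Measure (Tor α))) (fun t : Tor α =>
      Complex.exp (∑ x, ∑ y, N x y * ph t x y * Complex.exp (0 * ((v x - v y : ℝ) : ℂ))))
      (fun x => ((s * v x : ℝ) : AddCircle (2 * Real.pi)))]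
    congr 1
    ext t
    congr 1
    refine Finset.sum_congr rfl fun x _ => Finset.sum_congr rfl fun y _ => ?_
    rw [ph_shift]
    push_cast
    rw [zero_mul, Complex.exp_zero, mul_one, mul_assoc]
    congr 3
    ring
  have := h1.eq_of_frequently_eq h2 (z₀ := 0) ?_
  · exact congrFun this z
  · have ht : Filter.Tendsto (fun s : ℝ => Complex.I * (s : ℂ)) (nhdsWithin 0 {0}ᶜ) (nhdsWithin 0 {0}ᶜ) := by
      refine tendsto_nhdsWithin_iff.2 ⟨?_, ?_⟩
      · have : Continuous (fun s : ℝ => Complex.I * (s : ℂ)) := by fun_prop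
        have h := this.tendsto 0
        simp only [Complex.ofReal_zero, mul_zero] at h
        exact h.mono_left nhdsWithin_le_nhds
      · filter_upwards [self_mem_nhdsWithin] with s hs
        simpa using hs
    exact ht.frequently (Filter.Frequently.of_forall fun s => key s)

end torus

section density

set_option linter.unusedSectionVars false

variable {α : Type*} [Fintype α] [DecidableEq α]

/-- The symbol of `∂_x`. -/
def VV (A : Matrix α α ℝ) (c : α → ℝ) (t : Tor α) (x : α) : ℂ :=
  ∑ y, ((A x y * (c x / c y) : ℝ) : ℂ) * ph t x y

lemma continuous_VV (A : Matrix α α ℝ) (c : α → ℝ) (x : α) :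
    Continuous (fun t : Tor α => VV A c t x) := by
  have hc := fun x y => continuous_ph (α := α) x y
  unfold VV
  fun_prop

lemma GM_eq (A : Matrix α α ℝ) (c : α → ℝ) (hc : ∀ x, 0 < c x) (l : α → ℝ) (hl : ∀ x, 0 < l x) :
    GM A l = ((2 * Real.pi : ℂ) ^ (Fintype.card α))⁻¹ *
      ∫ t : Tor α, Complex.exp (∑ x, (l x : ℂ) * VV A c t x) := by
  rw [GM_torus]
  congr 1
  have h := KK_const (fun x y => (A x y : ℂ) * (Real.sqrt (l x * l y) : ℂ))
    (fun x => Real.log (Real.sqrt (l x) * c x)) 1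
  unfold KK at h
  simp only [zero_mul, Complex.exp_zero, mul_one, one_mul] at h
  rw [← h]
  congr 1
  ext t
  congr 1
  refine Finset.sum_congr rfl fun x _ => ?_
  unfold VV
  rw [Finset.mul_sum]
  refine Finset.sum_congr rfl fun y _ => ?_
  have hx := Real.sqrt_pos.2 (hl x)
  have hy := Real.sqrt_pos.2 (hl y)
  rw [← Complex.ofReal_exp, Real.exp_sub, Real.exp_log (mul_pos hx (hc x)),
    Real.exp_log (mul_pos hy (hc y)), Real.sqrt_mul (hl x).le]
  have e : A x y * (Real.sqrt (l x) * Real.sqrt (l y)) *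
      (Real.sqrt (l x) * c x / (Real.sqrt (l y) * c y)) = l x * (A x y * (c x / c y)) := by
    have h1 := (hc y).ne'
    have h2 := hy.ne'
    have h3 : Real.sqrt (l x) ^ 2 = l x := Real.sq_sqrt (hl x).le
    field_simp
    rw [h3]
    ring
  have e' := congrArg (fun r : ℝ => (r : ℂ)) e
  push_cast at e' ⊢
  linear_combination (ph t x y) * e'

lemma pd_int (g : Tor α → ℂ) (hg : Continuous g) (V : Tor α → α → ℂ)
    (hV : ∀ x, Continuous fun t => V t x) (C : ℂ) (x : α) (l : α → ℝ) :
    pd x (fun l => C * ∫ t, g t * Complex.exp (∑ x, (l x : ℂ) * V t x)) l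
      = C * ∫ t, (V t x * g t) * Complex.exp (∑ x, (l x : ℂ) * V t x) := by
  have hE : Continuous (fun p : (α → ℝ) × Tor α =>
      g p.2 * Complex.exp (∑ x, (p.1 x : ℂ) * V p.2 x)) := by
    have h1 : ∀ x, Continuous fun p : (α → ℝ) × Tor α => V p.2 x :=
      fun x => (hV x).comp continuous_snd
    have h2 : Continuous fun p : (α → ℝ) × Tor α => g p.2 := hg.comp continuous_snd
    fun_prop
  have hF' : Continuous (fun p : (α → ℝ) × Tor α =>
      (g p.2 * Complex.exp (∑ x, (p.1 x : ℂ) * V p.2 x)) •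
        ∑ x, (V p.2 x) • (Complex.ofRealCLM.comp (ContinuousLinearMap.proj (R := ℝ) (φ := fun _ : α => ℝ) x))) := by
    refine hE.smul ?_
    refine continuous_finsetSum _ fun x _ => ?_
    exact ((hV x).comp continuous_snd).smul continuous_const
  have h := hasFDerivAt_int (𝕜 := ℝ) (E := α → ℝ) (X := Tor α) volume
    (fun l t => g t * Complex.exp (∑ x, (l x : ℂ) * V t x))
    (fun l t => (g t * Complex.exp (∑ x, (l x : ℂ) * V t x)) •
        ∑ x, (V t x) • (Complex.ofRealCLM.comp (ContinuousLinearMap.proj (R := ℝ) (φ := fun _ : α => ℝ) x)))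
    (fun e => by fun_prop) hF' ?_ l
  · unfold pd
    rw [(h.const_mul C).fderiv, smul_apply, smul_eq_mul]
    congr 1
    rw [ContinuousLinearMap.integral_apply]
    · congr 1
      ext t
      have hs : ∑ y, V t y * ((if y = x then (1:ℝ) else 0 : ℝ) : ℂ) = V t x := by
        rw [Finset.sum_eq_single x] <;> simp +contextual
      simp [Pi.single_apply, hs]
      ring
    · have : Continuous (fun t : Tor α => (g t * Complex.exp (∑ x, (l x : ℂ) * V t x)) •
        ∑ x, (V t x) • (Complex.ofRealCLM.comp (ContinuousLinearMap.proj (R := ℝ) (φ := fun _ : α => ℝ) x))) :=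
        hF'.comp (Continuous.prodMk_right l)
      exact this.integrable_of_hasCompactSupport (HasCompactSupport.of_compactSpace _)
  · intro e t
    have h1 : HasFDerivAt (fun e : α → ℝ => ∑ x, (e x : ℂ) * V t x)
        (∑ x, (V t x) • (Complex.ofRealCLM.comp (ContinuousLinearMap.proj (R := ℝ) (φ := fun _ : α => ℝ) x))) e := by
      refine HasFDerivAt.fun_sum fun x _ => ?_
      exact (Complex.ofRealCLM.comp (ContinuousLinearMap.proj (R := ℝ) (φ := fun _ : α => ℝ) x)).hasFDerivAt.mul_const (V t x)
    have h2 := (h1.cexp).const_mul (g t)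
    rwa [smul_smul] at h2

lemma foldr_eq (A : Matrix α α ℝ) (c : α → ℝ) (hc : ∀ x, 0 < c x) (L : List α) :
    ∀ l : α → ℝ, (∀ x, 0 < l x) → L.foldr pd (GM A) l =
      ((2 * Real.pi : ℂ) ^ (Fintype.card α))⁻¹ *
      ∫ t : Tor α, (L.map (VV A c t)).prod * Complex.exp (∑ x, (l x : ℂ) * VV A c t x) := by
  induction L with
  | nil =>
    intro l hl
    simpa using GM_eq A c hc l hl
  | cons x L ih =>
    intro l hl
    have hg : Continuous (fun t : Tor α => (L.map (VV A c t)).prod) := by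
      refine continuous_list_prod (f := fun x t => VV A c t x) L fun x _ => continuous_VV A c x
    simp only [List.map_cons, List.prod_cons, List.foldr_cons]
    rw [← pd_int _ hg _ (continuous_VV A c)]
    have hopen : {l : α → ℝ | ∀ x, 0 < l x} ∈ nhds l := by
      refine IsOpen.mem_nhds ?_ hl
      have : {l : α → ℝ | ∀ x, 0 < l x} = Set.univ.pi (fun _ => Set.Ioi 0) := by ext; simp
      rw [this]
      exact isOpen_set_pi Set.finite_univ fun _ _ => isOpen_Ioi
    unfold pd
    rw [Filter.EventuallyEq.fderiv_eq]
    filter_upwards [hopen] with l' hl'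
    exact ih l' hl'

/-- The cofactor matrix. -/
def DD (A : Matrix α α ℝ) (a b : α) (V : α → ℂ) : Matrix α α ℂ :=
  Matrix.of fun x y : α => if x = b then (if y = a then (1:ℂ) else 0)
    else (if y = a then 0 else ((-A).map (fun r => (r : ℂ)) + Matrix.diagonal V) x y)

lemma rho_eq (A : Matrix α α ℝ) (c : α → ℝ) (hc : ∀ x, 0 < c x) (a b : α)
    (l : α → ℝ) (hl : ∀ x, 0 < l x) :
    rho A a b l = ((2 * Real.pi : ℂ) ^ (Fintype.card α))⁻¹ *
      ∫ t : Tor α, (DD A a b (VV A c t)).det * Complex.exp (∑ x, (l x : ℂ) * VV A c t x) := by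
  unfold rho ddet DD
  simp_rw [← sum_cofDet, Finset.sum_mul]
  have hV := continuous_VV A c
  rw [integral_finsetSum, Finset.mul_sum]
  · refine Finset.sum_congr rfl fun Q _ => ?_
    rw [mpart, foldr_eq A c hc _ l hl, mul_left_comm]
    congr 1
    rw [← integral_const_mul]
    congr 1
    ext t
    rw [Finset.prod_map_toList, mul_assoc]
  · intro Q _
    refine Continuous.integrable_of_hasCompactSupport ?_ (HasCompactSupport.of_compactSpace _)
    fun_prop

lemma DD_bound (A : Matrix α α ℝ) (hs : ∀ x y, A x y = A y x) (η T : ℝ)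
    (hη0 : 0 ≤ η) (hη : ∀ x, ∑ y ∈ Finset.univ.erase x, |A x y| ≤ η)
    (a b : α) (l : α → ℝ) (hl : ∀ x, 0 < l x) (hlT : ∀ x, l x ≤ T) (t : Tor α) :
    ‖(DD A a b (VV A (fun x => (Real.sqrt (l x))⁻¹) t)).det‖
      ≤ ∏ y : {y // y ≠ a}, (2 * η * Real.sqrt (T / l y)) := by
  refine (norm_det_le_cols _).trans ?_
  rw [← Finset.mul_prod_erase _ _ (Finset.mem_univ a)]
  have ha : ∑ x, ‖DD A a b (VV A (fun x => (Real.sqrt (l x))⁻¹) t) x a‖ = 1 := by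
    rw [Finset.sum_eq_single b]
    · simp [DD]
    · intro x _ hx; simp [DD, hx]
    · simp
  rw [ha, one_mul]
  have hp : ∏ y : {y // y ≠ a}, (2 * η * Real.sqrt (T / l y))
      = ∏ y ∈ Finset.univ.erase a, (2 * η * Real.sqrt (T / l y)) :=
    (Finset.prod_subtype (Finset.univ.erase a) (by simp)
      (fun y => 2 * η * Real.sqrt (T / l y))).symm
  rw [hp]
  refine Finset.prod_le_prod (fun y _ => by positivity) fun y hy => ?_
  have hya : y ≠ a := (Finset.mem_erase.1 hy).1
  have h1 : 1 ≤ Real.sqrt (T / l y) := by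
    rw [Real.one_le_sqrt, one_le_div (hl y)]; exact hlT y
  set V := VV A (fun x => (Real.sqrt (l x))⁻¹) t with hV
  have hstep : ∀ x, ‖DD A a b V x y‖ ≤ ‖((-A).map (fun r => (r : ℂ)) + Matrix.diagonal V) x y‖ := by
    intro x
    by_cases hx : x = b
    · simp [DD, hx, hya]
    · simp [DD, hx, hya]
  refine (Finset.sum_le_sum fun x _ => hstep x).trans ?_
  rw [← Finset.add_sum_erase _ _ (Finset.mem_univ y)]
  have h2 : ∑ x ∈ Finset.univ.erase y, ‖((-A).map (fun r => (r : ℂ)) + Matrix.diagonal V) x y‖ ≤ η := by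
    refine le_trans (le_of_eq ?_) (hη y)
    refine Finset.sum_congr rfl fun x hx => ?_
    have : x ≠ y := (Finset.mem_erase.1 hx).1
    simp [this, hs x y]
  have h3 : ((-A).map (fun r => (r : ℂ)) + Matrix.diagonal V) y y
      = ∑ z ∈ Finset.univ.erase y, ((A y z * (Real.sqrt (l z) / Real.sqrt (l y)) : ℝ) : ℂ) * ph t y z := by
    have hne : Real.sqrt (l y) ≠ 0 := (Real.sqrt_pos.2 (hl y)).ne'
    simp only [Matrix.add_apply, Matrix.diagonal_apply_eq, Matrix.map_apply, Matrix.neg_apply, hV, VV]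
    rw [← Finset.add_sum_erase _ _ (Finset.mem_univ y), ph_self]
    rw [div_self (inv_ne_zero hne), ← add_assoc]
    simp only [mul_one, Complex.ofReal_neg, neg_add_cancel, zero_add]
    refine Finset.sum_congr rfl fun z _ => ?_
    congr 3
    rw [inv_div_inv]
  have h4 : ‖((-A).map (fun r => (r : ℂ)) + Matrix.diagonal V) y y‖ ≤ η * Real.sqrt (T / l y) := by
    rw [h3]
    refine (norm_sum_le _ _).trans ?_
    refine le_trans ?_ (mul_le_mul_of_nonneg_right (hη y) (Real.sqrt_nonneg _))
    rw [Finset.sum_mul]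
    refine Finset.sum_le_sum fun z _ => ?_
    rw [norm_mul, norm_ph, mul_one, Complex.norm_real, norm_mul, Real.norm_eq_abs]
    refine mul_le_mul_of_nonneg_left ?_ (abs_nonneg _)
    rw [Real.norm_of_nonneg (by positivity), ← Real.sqrt_div (hl z).le]
    refine Real.sqrt_le_sqrt ?_
    exact div_le_div_of_nonneg_right (hlT z) (hl y).le
  nlinarith

lemma exp_bound (A : Matrix α α ℝ) (hA : ∀ x y, x ≠ y → 0 ≤ A x y)
    (l : α → ℝ) (hl : ∀ x, 0 < l x) (t : Tor α) :
    ‖Complex.exp (∑ x, (l x : ℂ) * VV A (fun x => (Real.sqrt (l x))⁻¹) t x)‖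
      ≤ Real.exp (∑ x, ∑ y, Real.sqrt (l x) * A x y * Real.sqrt (l y)) := by
  rw [Complex.norm_exp]
  refine Real.exp_le_exp.2 ?_
  rw [Complex.re_sum]
  refine Finset.sum_le_sum fun x _ => ?_
  rw [VV, Finset.mul_sum, Complex.re_sum]
  refine Finset.sum_le_sum fun y _ => ?_
  have hx := Real.sqrt_pos.2 (hl x)
  rw [← mul_assoc, ← Complex.ofReal_mul, Complex.re_ofReal_mul]
  have e : l x * (A x y * ((Real.sqrt (l x))⁻¹ / (Real.sqrt (l y))⁻¹))
      = Real.sqrt (l x) * A x y * Real.sqrt (l y) := by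
    rw [inv_div_inv]
    nth_rewrite 1 [← Real.mul_self_sqrt (hl x).le]
    field_simp
  rw [e]
  by_cases hxy : x = y
  · subst hxy
    simp [ph_self]
  · have h0 := hA x y hxy
    have : (ph t x y).re ≤ 1 := (Complex.re_le_norm _).trans (norm_ph t x y).le
    exact mul_le_of_le_one_right (by positivity) this

lemma rho_bound (A : Matrix α α ℝ) (hs : ∀ x y, A x y = A y x) (hA : ∀ x y, x ≠ y → 0 ≤ A x y)
    (η T : ℝ) (hη0 : 0 ≤ η) (hη : ∀ x, ∑ y ∈ Finset.univ.erase x, |A x y| ≤ η)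
    (a b : α) (l : α → ℝ) (hl : ∀ x, 0 < l x) (hlT : ∀ x, l x ≤ T) :
    (rho A a b l).re ≤ (∏ y : {y // y ≠ a}, (2 * η * Real.sqrt (T / l y))) *
      Real.exp (∑ x, ∑ y, Real.sqrt (l x) * A x y * Real.sqrt (l y)) := by
  refine (Complex.re_le_norm _).trans ?_
  rw [rho_eq A (fun x => (Real.sqrt (l x))⁻¹) (fun x => inv_pos.2 (Real.sqrt_pos.2 (hl x))) a b l hl]
  rw [norm_mul]
  have h := norm_integral_le_of_norm_le_const (μ := (volume : Measure (Tor α)))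
    (f := fun t : Tor α => (DD A a b (VV A (fun x => (Real.sqrt (l x))⁻¹) t)).det *
      Complex.exp (∑ x, (l x : ℂ) * VV A (fun x => (Real.sqrt (l x))⁻¹) t x))
    (C := (∏ y : {y // y ≠ a}, (2 * η * Real.sqrt (T / l y))) *
      Real.exp (∑ x, ∑ y, Real.sqrt (l x) * A x y * Real.sqrt (l y)))
    (Filter.Eventually.of_forall fun t => by
      rw [norm_mul]
      exact mul_le_mul (DD_bound A hs η T hη0 hη a b l hl hlT t) (exp_bound A hA l hl t)
        (norm_nonneg _) (Finset.prod_nonneg fun y _ => by positivity))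
  rw [vol_torus] at h
  have hn : ‖((2 * Real.pi : ℂ) ^ (Fintype.card α))⁻¹‖ = ((2 * Real.pi) ^ (Fintype.card α))⁻¹ := by
    rw [norm_inv, norm_pow, norm_mul, Complex.norm_real, Real.norm_of_nonneg Real.pi_pos.le]
    simp
  rw [hn]
  have hp : (0:ℝ) < (2 * Real.pi) ^ (Fintype.card α) := pow_pos Real.two_pi_pos _
  rw [inv_mul_le_iff₀ hp, mul_comm ((2 * Real.pi) ^ (Fintype.card α))]
  exact h

end density

section final

lemma integrable_sqrt_inv (k T : ℝ) (hT : 0 < T) :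
    Integrable (fun t : ℝ => k * Real.sqrt (T / t)) (volume.restrict (Set.Ioo 0 T)) ∧
    ∫ t in Set.Ioo 0 T, k * Real.sqrt (T / t) = k * (2 * T) := by
  have he : Set.EqOn (fun t : ℝ => k * Real.sqrt (T / t))
      (fun t => (k * Real.sqrt T) * t ^ (-(1/2) : ℝ)) (Set.Ioo 0 T) := by
    intro t ht
    simp only
    rw [Real.sqrt_div hT.le, Real.rpow_neg ht.1.le, Real.sqrt_eq_rpow t]
    ring
  have hi : IntervalIntegrable (fun t : ℝ => (k * Real.sqrt T) * t ^ (-(1/2) : ℝ)) volume 0 T :=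
    (intervalIntegral.intervalIntegrable_rpow' (by norm_num)).const_mul _
  constructor
  · rw [intervalIntegrable_iff_integrableOn_Ioo_of_le hT.le] at hi
    exact hi.congr_fun he.symm measurableSet_Ioo
  · rw [setIntegral_congr_fun measurableSet_Ioo he, ← integral_Ioc_eq_integral_Ioo,
      ← intervalIntegral.integral_of_le hT.le, intervalIntegral.integral_const_mul,
      integral_rpow (Or.inl (by norm_num))]
    have h1 : (-(1/2) + 1 : ℝ) = 1/2 := by norm_num
    rw [h1, Real.zero_rpow (by norm_num), ← Real.sqrt_eq_rpow]
    have := Real.mul_self_sqrt hT.le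
    linear_combination (2 * k) * this

lemma lint_simplex {ι : Type*} [Fintype ι] (k T : ℝ) (hk : 0 ≤ k) (hT : 0 < T) :
    ∫⁻ t in {t : ι → ℝ | (∀ x, 0 < t x) ∧ ∑ x, t x < T},
      ENNReal.ofReal (∏ x, (k * Real.sqrt (T / t x)))
      ≤ ENNReal.ofReal ((k * (2 * T)) ^ Fintype.card ι) := by
  have hsub : {t : ι → ℝ | (∀ x, 0 < t x) ∧ ∑ x, t x < T} ⊆ Set.univ.pi (fun _ => Set.Ioo 0 T) := by
    intro t ht x _
    exact ⟨ht.1 x, (Finset.single_le_sum (fun y _ => (ht.1 y).le) (Finset.mem_univ x)).trans_lt ht.2⟩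
  refine (lintegral_mono_set hsub).trans ?_
  have h3 : (volume : Measure (ι → ℝ)) = Measure.pi (fun _ => volume) := rfl
  obtain ⟨h1, h2⟩ := integrable_sqrt_inv k T hT
  rw [h3, Measure.restrict_pi_pi, ← ofReal_integral_eq_lintegral_ofReal]
  · rw [integral_fintype_prod_eq_pow (fun t : ℝ => k * Real.sqrt (T / t)), h2]
  · exact Integrable.fintype_prod (f := fun _ : ι => fun t : ℝ => k * Real.sqrt (T / t)) (fun _ => h1)
  · exact Filter.Eventually.of_forall fun t => Finset.prod_nonneg fun x _ => by positivity

lemma sum_ext {S : Type*} [Fintype S] [DecidableEq S] (R : Finset S) (f : S → ℝ)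
    (hf : ∀ x, x ∉ R → f x = 0) : ∑ x, f x = ∑ x : R, f x := by
  rw [Finset.sum_coe_sort R f]
  exact (Finset.sum_subset (Finset.subset_univ R) fun x _ hx => hf x hx).symm

lemma term_bound {S : Type*} [Fintype S] [DecidableEq S]
    (A : Matrix S S ℝ)
    (hA_symm : ∀ x y, A x y = A y x)
    (hA_offdiag : ∀ x y, x ≠ y → 0 ≤ A x y)
    (T : ℝ) (hT : 1 ≤ T) (η : ℝ) (hη1 : 1 ≤ η)
    (hη : ∀ x, ∑ y ∈ Finset.univ \ {x}, |A x y| ≤ η)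
    (Γ : Set (S → ℝ)) (R : Finset S) (a b : R) :
    sigmaLInt a T (fun l : R → ℝ =>
            ENNReal.ofReal
              (Set.indicator Γ (fun _ => (1:ℝ))
                  (fun x : S => if hx : x ∈ R then l ⟨x, hx⟩ / T else 0) *
                (rho (Matrix.of fun x y : R => A x y) a b l).re))
      ≤ ENNReal.ofReal ((4 * η * T) ^ R.card) * ⨆ μ ∈ Γ, ENNReal.ofReal
            (Real.exp (-T * ∑ x, ∑ y,
              Real.sqrt (μ x) * (-(A x y)) * Real.sqrt (μ y))) := by
  have hT0 : 0 < T := by linarith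
  set D := ⨆ μ ∈ Γ, ENNReal.ofReal
            (Real.exp (-T * ∑ x, ∑ y,
              Real.sqrt (μ x) * (-(A x y)) * Real.sqrt (μ y))) with hD
  have hmeas : MeasurableSet {t : {x : R // x ≠ a} → ℝ | (∀ x, 0 < t x) ∧ ∑ x, t x < T} := by
    have h1 : MeasurableSet {t : {x : R // x ≠ a} → ℝ | ∀ x, 0 < t x} := by
      rw [Set.ofPred_forall]
      exact MeasurableSet.iInter fun x => measurableSet_lt measurable_const (measurable_pi_apply x)
    have h2 : MeasurableSet {t : {x : R // x ≠ a} → ℝ | ∑ x, t x < T} :=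
      measurableSet_lt (by fun_prop) measurable_const
    exact h1.inter h2
  unfold sigmaLInt
  have key : ∀ t ∈ {t : {x : R // x ≠ a} → ℝ | (∀ x, 0 < t x) ∧ ∑ x, t x < T},
      (fun l : R → ℝ =>
            ENNReal.ofReal
              (Set.indicator Γ (fun _ => (1:ℝ))
                  (fun x : S => if hx : x ∈ R then l ⟨x, hx⟩ / T else 0) *
                (rho (Matrix.of fun x y : R => A x y) a b l).re))
        (fun x => if hx : x = a then T - ∑ y, t y else t ⟨x, hx⟩)
      ≤ ENNReal.ofReal (∏ x, (2 * η * Real.sqrt (T / t x))) * D := by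
    intro t ht
    set l : R → ℝ := fun x => if hx : x = a then T - ∑ y, t y else t ⟨x, hx⟩ with hl_def
    simp only
    by_cases hμ : (fun x : S => if hx : x ∈ R then l ⟨x, hx⟩ / T else 0) ∈ Γ
    swap
    · rw [Set.indicator_of_notMem hμ]; simp
    rw [Set.indicator_of_mem hμ, one_mul]
    have hl : ∀ x, 0 < l x := by
      intro x
      simp only [hl_def]
      split_ifs with hx
      · linarith [ht.2]
      · exact ht.1 _
    have hlT : ∀ x, l x ≤ T := by
      intro x
      simp only [hl_def]
      split_ifs with hx
      · have := Finset.sum_nonneg (s := Finset.univ) fun y _ => (ht.1 y).le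
        linarith
      · exact (Finset.single_le_sum (fun y _ => (ht.1 y).le) (Finset.mem_univ _)).trans ht.2.le
    have hb := rho_bound (Matrix.of fun x y : R => A x y) (fun x y => hA_symm x y)
      (fun x y hxy => hA_offdiag x y fun h => hxy (Subtype.ext h)) η T (by linarith)
      (fun x => by
        refine le_trans ?_ (hη x)
        have := Finset.sum_map (Finset.univ.erase x) (Function.Embedding.subtype (· ∈ R))
          (fun y : S => |A x y|)
        simp only [Matrix.of_apply]
        refine le_trans (le_of_eq this.symm) ?_
        refine Finset.sum_le_sum_of_subset_of_nonneg ?_ fun _ _ _ => abs_nonneg _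
        intro y hy
        simp only [Finset.mem_map, Finset.mem_erase] at hy
        obtain ⟨z, hz, rfl⟩ := hy
        simp only [Finset.mem_sdiff, Finset.mem_univ, true_and, Finset.mem_singleton]
        exact fun h => hz.1 (Subtype.ext h)) a b l hl hlT
    refine (ENNReal.ofReal_le_ofReal hb).trans ?_
    rw [ENNReal.ofReal_mul (Finset.prod_nonneg fun y _ => by positivity)]
    have hP : ∏ y : {y // y ≠ a}, (2 * η * Real.sqrt (T / l y))
        = ∏ x, (2 * η * Real.sqrt (T / t x)) := by
      refine Finset.prod_congr rfl fun y _ => ?_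
      simp [hl_def, y.2]
    rw [hP]
    refine mul_le_mul_right ?_ _
    refine le_trans (le_of_eq ?_) (le_iSup₂ (f := fun (μ : S → ℝ) (_ : μ ∈ Γ) => ENNReal.ofReal
            (Real.exp (-T * ∑ x, ∑ y,
              Real.sqrt (μ x) * (-(A x y)) * Real.sqrt (μ y)))) _ hμ)
    congr 2
    rw [sum_ext R]
    · rw [Finset.mul_sum]
      refine Finset.sum_congr rfl fun x _ => ?_
      rw [sum_ext R]
      · rw [Finset.mul_sum]
        refine Finset.sum_congr rfl fun y _ => ?_
        simp only [Finset.coe_mem, dite_true, Subtype.coe_eta, Matrix.of_apply]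
        rw [Real.sqrt_div (hl x).le, Real.sqrt_div (hl y).le]
        have h1 := Real.sqrt_pos.2 hT0
        nth_rewrite 1 [← Real.mul_self_sqrt hT0.le]
        field_simp
      · intro y hy
        simp [hy]
    · intro x hx
      simp [hx]
  refine (setLIntegral_mono' hmeas key).trans ?_
  rw [lintegral_mul_const]
  swap
  · refine ENNReal.measurable_ofReal.comp ?_
    refine Finset.measurable_prod _ fun x _ => ?_
    have : Measurable fun t : {x : R // x ≠ a} → ℝ => t x := measurable_pi_apply x
    fun_prop
  refine mul_le_mul_left ?_ _
  refine (lint_simplex (2 * η) T (by linarith) hT0).trans ?_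
  refine ENNReal.ofReal_le_ofReal ?_
  have : 2 * η * (2 * T) = 4 * η * T := by ring
  rw [this]
  refine pow_le_pow_right₀ (by nlinarith) ?_
  refine (Fintype.card_subtype_le _).trans (le_of_eq (Fintype.card_coe R))

lemma const_bound (n : ℕ) (η T : ℝ) (hη : 1 ≤ η) (hT : 1 ≤ T) :
    (1 + 4 * η * T) ^ n ≤ (η * Real.sqrt (8 * Real.exp 1) * T) ^ n * Real.exp ((n:ℝ) / (4 * T)) := by
  have h1 : Real.exp ((n:ℝ) / (4 * T)) = Real.exp (1 / (4 * T)) ^ n := by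
    rw [← Real.exp_nat_mul]; congr 1; ring
  rw [h1, ← mul_pow]
  refine pow_le_pow_left₀ (by nlinarith) ?_ n
  have h4 : 4 ≤ Real.sqrt (8 * Real.exp 1) := by
    refine Real.le_sqrt_of_sq_le ?_
    have := Real.add_one_le_exp 1
    linarith
  have h5 := Real.add_one_le_exp (1 / (4 * T))
  have h6 : η * 4 * T ≤ η * Real.sqrt (8 * Real.exp 1) * T := by gcongr
  calc 1 + 4 * η * T ≤ (η * 4 * T) * (1 / (4 * T) + 1) := by
        field_simp
        nlinarith
    _ ≤ _ := by gcongr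

end final

/-- **Theorem 3.6(i): large deviation upper bound for arbitrary measurable sets.**
Let `A` be a symmetric sub-generator on `S`, `η_S` as in (3.2), `a ∈ S`, `T ≥ 1`,
and `Γ ⊆ M_1(S)` Borel measurable. Then
`Σ_{b∈S} Σ_{R : {a,b} ⊆ R ⊆ S} ∫_{M_T^+(R)} 1_Γ(ext_S(l/T)) ρ_{ab}^{(R)}(l) σ_T(dl)
 ≤ |S| (η_S √(8e) T)^{|S|} e^{|S|/(4T)} exp(−T inf_{μ∈Γ} Σ √μ_x(−A_{x,y})√μ_y)`
(with `inf ∅ = +∞`, i.e. the supremum form on the right). -/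
theorem large_deviation_upper_bound_measurable_set
    {S : Type*} [Fintype S] [DecidableEq S] [Nonempty S]
    (A : Matrix S S ℝ)
    (hA_symm : ∀ x y, A x y = A y x)
    (hA_offdiag : ∀ x y, x ≠ y → 0 ≤ A x y)
    (hA_rowsum : ∀ x, ∑ y, A x y ≤ 0)
    (a : S) (T : ℝ) (hT : 1 ≤ T)
    (η : ℝ)
    (hη : η = max
      (Finset.univ.sup' ⟨a, Finset.mem_univ a⟩
        (fun x => ∑ y ∈ Finset.univ \ {x}, |A x y|)) 1)
    (Γ : Set (S → ℝ)) (hΓ_meas : MeasurableSet Γ)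
    (hΓ_sub : Γ ⊆ {μ | (∀ x, 0 ≤ μ x ∧ μ x ≤ 1) ∧ ∑ x, μ x = 1}) :
    (∑ b : S, ∑ R : Finset S,
        (if h : a ∈ R ∧ b ∈ R then
          sigmaLInt (⟨a, h.1⟩ : R) T (fun l : R → ℝ =>
            ENNReal.ofReal
              (Set.indicator Γ (fun _ => (1:ℝ))
                  (fun x : S => if hx : x ∈ R then l ⟨x, hx⟩ / T else 0) *
                (rho (Matrix.of fun x y : R => A x y) ⟨a, h.1⟩ ⟨b, h.2⟩ l).re))
        else 0))
      ≤ ENNReal.ofReal ((Fintype.card S : ℝ) *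
            (η * Real.sqrt (8 * Real.exp 1) * T) ^ (Fintype.card S) *
            Real.exp ((Fintype.card S : ℝ) / (4 * T))) *
          ⨆ μ ∈ Γ, ENNReal.ofReal
            (Real.exp (-T * ∑ x, ∑ y,
              Real.sqrt (μ x) * (-(A x y)) * Real.sqrt (μ y))) := by
  have hη1 : 1 ≤ η := hη ▸ le_max_right _ _
  have hη2 : ∀ x, ∑ y ∈ Finset.univ \ {x}, |A x y| ≤ η := by
    intro x
    rw [hη]
    exact (Finset.le_sup' (fun x => ∑ y ∈ Finset.univ \ {x}, |A x y|)
      (Finset.mem_univ x)).trans (le_max_left _ _)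
  have hX : 0 ≤ 4 * η * T := by nlinarith
  refine (Finset.sum_le_sum (g := fun _ => ENNReal.ofReal ((1 + 4 * η * T) ^ Fintype.card S) *
    ⨆ μ ∈ Γ, ENNReal.ofReal
            (Real.exp (-T * ∑ x, ∑ y,
              Real.sqrt (μ x) * (-(A x y)) * Real.sqrt (μ y)))) fun b _ => ?_).trans ?_
  · refine (Finset.sum_le_sum (g := fun R : Finset S => ENNReal.ofReal ((4 * η * T) ^ R.card) *
      ⨆ μ ∈ Γ, ENNReal.ofReal
            (Real.exp (-T * ∑ x, ∑ y,
              Real.sqrt (μ x) * (-(A x y)) * Real.sqrt (μ y)))) fun R _ => ?_).trans ?_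
    · split_ifs with h
      · exact term_bound A hA_symm hA_offdiag T hT η hη1 hη2 Γ R ⟨a, h.1⟩ ⟨b, h.2⟩
      · exact zero_le
    · rw [← Finset.sum_mul, ← ENNReal.ofReal_sum_of_nonneg fun R _ => by positivity]
      refine le_of_eq ?_
      congr 2
      have := Fintype.sum_pow_mul_eq_add_pow S (4 * η * T) 1
      simp only [one_pow, mul_one] at this
      rw [this, add_comm]
  · rw [Finset.sum_const, nsmul_eq_mul, ← mul_assoc]
    refine mul_le_mul_left ?_ _
    rw [Finset.card_univ, ← ENNReal.ofReal_natCast, ← ENNReal.ofReal_mul (by positivity)]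
    refine ENNReal.ofReal_le_ofReal ?_
    rw [mul_assoc (Fintype.card S : ℝ)]
    exact mul_le_mul_of_nonneg_left (const_bound _ η T hη1 hT) (by positivity)

end
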